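/- arXiv:2504.12624 — 2 statements merged into one kernel-verified Lean document; each statement's English description precedes it below -/
import Mathlib

section
/- Let u : ℝ⁴ → ℝ be smooth with coordinates (x,y,z,t) and let λ ∈ ℝ. Define the first-order operators on smooth functions f : ℝ⁴ → ℝ by T f = f_t + (u_{xy} − λ) f_x − u_{xx} f_y and Z f = λ f_z − u_{yz} f_x + u_{zx} f_y. Then for every smooth f, T(Z f) − Z(T f) = −(∂_y M) f_x + (∂_x M) f_y, where M = u_{zt} + u_{zx} u_{xy} − u_{yz} u_{xx}. -/
/-- Partial derivative of `f` in the `i`-th coordinate direction. -/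
noncomputable def pd {n : ℕ} (i : Fin n) (f : (Fin n → ℝ) → ℝ) : (Fin n → ℝ) → ℝ :=
  fun p => fderiv ℝ f p (Pi.single i 1)

/-- Coordinates: x = 0, y = 1, z = 2, t = 3.
`T f = f_t + (u_{xy} − λ) f_x − u_{xx} f_y`. -/
noncomputable def Tlax (u : (Fin 4 → ℝ) → ℝ) (lam : ℝ) (f : (Fin 4 → ℝ) → ℝ) :
    (Fin 4 → ℝ) → ℝ :=
  fun q => pd 3 f q + (pd 0 (pd 1 u) q - lam) * pd 0 f q - pd 0 (pd 0 u) q * pd 1 f q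

/-- `Z f = λ f_z − u_{yz} f_x + u_{zx} f_y`. -/
noncomputable def Zlax (u : (Fin 4 → ℝ) → ℝ) (lam : ℝ) (f : (Fin 4 → ℝ) → ℝ) :
    (Fin 4 → ℝ) → ℝ :=
  fun q => lam * pd 2 f q - pd 1 (pd 2 u) q * pd 0 f q + pd 0 (pd 2 u) q * pd 1 f q

/-- `M = u_{zt} + u_{zx} u_{xy} − u_{yz} u_{xx}`. -/
noncomputable def Mheav (u : (Fin 4 → ℝ) → ℝ) : (Fin 4 → ℝ) → ℝ :=
  fun q => pd 2 (pd 3 u) q + pd 0 (pd 2 u) q * pd 0 (pd 1 u) q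
    - pd 1 (pd 2 u) q * pd 0 (pd 0 u) q

section pd

variable {n : ℕ} {f g : (Fin n → ℝ) → ℝ}

theorem ContDiff.pd (hf : ContDiff ℝ (⊤ : ℕ∞) f) (i : Fin n) :
    ContDiff ℝ (⊤ : ℕ∞) (pd i f) :=
  (hf.fderiv_right (m := (⊤ : ℕ∞)) (by simp)).clm_apply contDiff_const

theorem pd_add_apply {p : Fin n → ℝ} (i : Fin n) (hf : DifferentiableAt ℝ f p)
    (hg : DifferentiableAt ℝ g p) : pd i (fun q => f q + g q) p = pd i f p + pd i g p := by
  simp [pd, fderiv_fun_add hf hg]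

theorem pd_sub_apply {p : Fin n → ℝ} (i : Fin n) (hf : DifferentiableAt ℝ f p)
    (hg : DifferentiableAt ℝ g p) : pd i (fun q => f q - g q) p = pd i f p - pd i g p := by
  simp [pd, fderiv_fun_sub hf hg]

theorem pd_mul_apply {p : Fin n → ℝ} (i : Fin n) (hf : DifferentiableAt ℝ f p)
    (hg : DifferentiableAt ℝ g p) :
    pd i (fun q => f q * g q) p = f p * pd i g p + g p * pd i f p := by
  simp [pd, fderiv_fun_mul hf hg]

theorem pd_const_apply (p : Fin n → ℝ) (i : Fin n) (c : ℝ) : pd i (fun _ => c) p = 0 := by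
  simp [pd]

theorem pd_pd_apply (hf : ContDiff ℝ (⊤ : ℕ∞) f) (i j : Fin n) (p : Fin n → ℝ) :
    pd i (pd j f) p = fderiv ℝ (fderiv ℝ f) p (Pi.single i 1) (Pi.single j 1) := by
  have h : DifferentiableAt ℝ (fderiv ℝ f) p :=
    (hf.fderiv_right (m := (⊤ : ℕ∞)) (by simp)).differentiable (by simp) p
  change fderiv ℝ (fun q => fderiv ℝ f q (Pi.single j 1)) p (Pi.single i 1) = _
  simp [fderiv_clm_apply h (differentiableAt_const _)]

/-- Partial derivatives of a smooth function commute. -/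
theorem pd_comm (hf : ContDiff ℝ (⊤ : ℕ∞) f) (i j : Fin n) : pd i (pd j f) = pd j (pd i f) := by
  ext p
  rw [pd_pd_apply hf, pd_pd_apply hf]
  exact hf.contDiffAt.isSymmSndFDerivAt
    (by simpa using WithTop.coe_le_coe.2 (le_top : (2 : ℕ∞) ≤ ⊤)) _ _

end pd

/-- `T(Z f) − Z(T f) = −(∂_y M) f_x + (∂_x M) f_y` for all smooth `f`. -/
theorem stmt0 (u : (Fin 4 → ℝ) → ℝ) (hu : ContDiff ℝ (⊤ : ℕ∞) u) (lam : ℝ)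
    (f : (Fin 4 → ℝ) → ℝ) (hf : ContDiff ℝ (⊤ : ℕ∞) f) (q : Fin 4 → ℝ) :
    Tlax u lam (Zlax u lam f) q - Zlax u lam (Tlax u lam f) q =
      -(pd 1 (Mheav u) q) * pd 0 f q + pd 0 (Mheav u) q * pd 1 f q := by
  have diff_f (i : Fin 4) : Differentiable ℝ (pd i f) :=
    (hf.pd i).differentiable (by simp)
  have diff_u (i j : Fin 4) : Differentiable ℝ (pd i (pd j u)) :=
    ((hu.pd j).pd i).differentiable (by simp)
  have hM (i : Fin 4) : pd i (Mheav u) q = pd i (pd 2 (pd 3 u)) q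
      + (pd 0 (pd 2 u) q * pd i (pd 0 (pd 1 u)) q + pd 0 (pd 1 u) q * pd i (pd 0 (pd 2 u)) q)
      - (pd 1 (pd 2 u) q * pd i (pd 0 (pd 0 u)) q
        + pd 0 (pd 0 u) q * pd i (pd 1 (pd 2 u)) q) := by
    unfold Mheav
    rw [pd_sub_apply, pd_add_apply, pd_mul_apply, pd_mul_apply] <;> fun_prop
  have hT (i : Fin 4) : pd i (Tlax u lam f) q = pd i (pd 3 f) q
      + ((pd 0 (pd 1 u) q - lam) * pd i (pd 0 f) q + pd 0 f q * pd i (pd 0 (pd 1 u)) q)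
      - (pd 0 (pd 0 u) q * pd i (pd 1 f) q + pd 1 f q * pd i (pd 0 (pd 0 u)) q) := by
    unfold Tlax
    rw [pd_sub_apply, pd_add_apply, pd_mul_apply, pd_mul_apply, pd_sub_apply, pd_const_apply,
      sub_zero] <;> fun_prop
  have hZ (i : Fin 4) : pd i (Zlax u lam f) q = lam * pd i (pd 2 f) q
      - (pd 1 (pd 2 u) q * pd i (pd 0 f) q + pd 0 f q * pd i (pd 1 (pd 2 u)) q)
      + (pd 0 (pd 2 u) q * pd i (pd 1 f) q + pd 1 f q * pd i (pd 0 (pd 2 u)) q) := by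
    unfold Zlax
    rw [pd_add_apply, pd_sub_apply, pd_mul_apply, pd_mul_apply, pd_mul_apply, pd_const_apply,
      mul_zero, add_zero] <;> fun_prop
  rw [Tlax, Zlax]
  simp only [hM, hT, hZ]
  simp only [pd_comm, hf, hu, ContDiff.pd]
  ring
end

section
/- Let u : ℝ⁵ → ℝ be smooth with coordinates (x,y,z,t,t₂) and let λ ∈ ℝ. Define T₁ f = f_t − (λ − u_{xy}) f_x − u_{xx} f_y and T₂ f = f_{t₂} − (λ² − λ u_{xy} − u_{ty}) f_x − (λ u_{xx} + u_{tx}) f_y on smooth functions f. Then T₁(T₂ f) − T₂(T₁ f) = −(∂_y E) f_x + (∂_x E) f_y for every smooth f, where E = u_{x t₂} + u_{xx} u_{yt} − u_{xt} u_{xy} − u_{tt}. Consequently T₁ and T₂ commute for every λ ∈ ℝ if and only if ∂_x E = ∂_y E = 0; in particular they commute whenever E = 0. -/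
/-- Coordinates: x = 0, y = 1, z = 2, t = 3, t₂ = 4.
`T₁ f = f_t − (λ − u_{xy}) f_x − u_{xx} f_y`. -/
noncomputable def T1 (u : (Fin 5 → ℝ) → ℝ) (lam : ℝ) (f : (Fin 5 → ℝ) → ℝ) :
    (Fin 5 → ℝ) → ℝ :=
  fun q => pd 3 f q - (lam - pd 0 (pd 1 u) q) * pd 0 f q - pd 0 (pd 0 u) q * pd 1 f q

/-- `T₂ f = f_{t₂} − (λ² − λ u_{xy} − u_{ty}) f_x − (λ u_{xx} + u_{tx}) f_y`. -/
noncomputable def T2 (u : (Fin 5 → ℝ) → ℝ) (lam : ℝ) (f : (Fin 5 → ℝ) → ℝ) :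
    (Fin 5 → ℝ) → ℝ :=
  fun q => pd 4 f q - (lam ^ 2 - lam * pd 0 (pd 1 u) q - pd 3 (pd 1 u) q) * pd 0 f q
    - (lam * pd 0 (pd 0 u) q + pd 3 (pd 0 u) q) * pd 1 f q

/-- `E = u_{x t₂} + u_{xx} u_{yt} − u_{xt} u_{xy} − u_{tt}`. -/
noncomputable def Efun (u : (Fin 5 → ℝ) → ℝ) : (Fin 5 → ℝ) → ℝ :=
  fun q => pd 0 (pd 4 u) q + pd 0 (pd 0 u) q * pd 1 (pd 3 u) q
    - pd 0 (pd 3 u) q * pd 0 (pd 1 u) q - pd 3 (pd 3 u) q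

section PartialDerivatives

variable {n : ℕ} {f g : (Fin n → ℝ) → ℝ}

theorem pd_const (i : Fin n) (c : ℝ) (p : Fin n → ℝ) : pd i (fun _ => c) p = 0 := by
  simp [pd]

theorem pd_add (hf : Differentiable ℝ f) (hg : Differentiable ℝ g) (i : Fin n)
    (p : Fin n → ℝ) : pd i (fun q => f q + g q) p = pd i f p + pd i g p := by
  simp [pd, fderiv_fun_add (hf p) (hg p)]

theorem pd_sub (hf : Differentiable ℝ f) (hg : Differentiable ℝ g) (i : Fin n)
    (p : Fin n → ℝ) : pd i (fun q => f q - g q) p = pd i f p - pd i g p := by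
  simp [pd, fderiv_fun_sub (hf p) (hg p)]

theorem pd_mul (hf : Differentiable ℝ f) (hg : Differentiable ℝ g) (i : Fin n)
    (p : Fin n → ℝ) :
    pd i (fun q => f q * g q) p = f p * pd i g p + g p * pd i f p := by
  simp [pd, fderiv_fun_mul (hf p) (hg p)]

theorem pd_coord (i j : Fin n) (p : Fin n → ℝ) :
    pd i (fun q => q j) p = (Pi.single i 1 : Fin n → ℝ) j := by
  rw [pd, (hasFDerivAt_apply j p).fderiv]
  rfl

end PartialDerivatives

section Commutator

variable {u f : (Fin 5 → ℝ) → ℝ}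

theorem pd_T1 (hu : ContDiff ℝ (⊤ : ℕ∞) u) (hf : ContDiff ℝ (⊤ : ℕ∞) f) (lam : ℝ)
    (i : Fin 5) (q : Fin 5 → ℝ) :
    pd i (T1 u lam f) q = pd i (pd 3 f) q
      - ((lam - pd 0 (pd 1 u) q) * pd i (pd 0 f) q - pd 0 f q * pd i (pd 0 (pd 1 u)) q)
      - (pd 0 (pd 0 u) q * pd i (pd 1 f) q + pd 1 f q * pd i (pd 0 (pd 0 u)) q) := by
  have df (k) : Differentiable ℝ (pd k f) := (hf.pd k).differentiable (by simp)
  have du (k l) : Differentiable ℝ (pd k (pd l u)) :=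
    ((hu.pd l).pd k).differentiable (by simp)
  unfold T1
  simp (discharger := fun_prop) only [pd_sub, pd_mul, pd_const]
  ring

theorem pd_T2 (hu : ContDiff ℝ (⊤ : ℕ∞) u) (hf : ContDiff ℝ (⊤ : ℕ∞) f) (lam : ℝ)
    (i : Fin 5) (q : Fin 5 → ℝ) :
    pd i (T2 u lam f) q = pd i (pd 4 f) q
      - ((lam ^ 2 - lam * pd 0 (pd 1 u) q - pd 3 (pd 1 u) q) * pd i (pd 0 f) q
        - pd 0 f q * (lam * pd i (pd 0 (pd 1 u)) q + pd i (pd 3 (pd 1 u)) q))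
      - ((lam * pd 0 (pd 0 u) q + pd 3 (pd 0 u) q) * pd i (pd 1 f) q
        + pd 1 f q * (lam * pd i (pd 0 (pd 0 u)) q + pd i (pd 3 (pd 0 u)) q)) := by
  have df (k) : Differentiable ℝ (pd k f) := (hf.pd k).differentiable (by simp)
  have du (k l) : Differentiable ℝ (pd k (pd l u)) :=
    ((hu.pd l).pd k).differentiable (by simp)
  unfold T2
  simp (discharger := fun_prop) only [pd_sub, pd_add, pd_mul, pd_const]
  ring

theorem pd_Efun (hu : ContDiff ℝ (⊤ : ℕ∞) u) (i : Fin 5) (q : Fin 5 → ℝ) :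
    pd i (Efun u) q = pd i (pd 0 (pd 4 u)) q
      + (pd 0 (pd 0 u) q * pd i (pd 1 (pd 3 u)) q + pd 1 (pd 3 u) q * pd i (pd 0 (pd 0 u)) q)
      - (pd 0 (pd 3 u) q * pd i (pd 0 (pd 1 u)) q + pd 0 (pd 1 u) q * pd i (pd 0 (pd 3 u)) q)
      - pd i (pd 3 (pd 3 u)) q := by
  have du (k l) : Differentiable ℝ (pd k (pd l u)) :=
    ((hu.pd l).pd k).differentiable (by simp)
  unfold Efun
  simp (discharger := fun_prop) only [pd_sub, pd_add, pd_mul]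

theorem T1_T2_commutator (hu : ContDiff ℝ (⊤ : ℕ∞) u) (hf : ContDiff ℝ (⊤ : ℕ∞) f)
    (lam : ℝ) (q : Fin 5 → ℝ) :
    T1 u lam (T2 u lam f) q - T2 u lam (T1 u lam f) q =
      -(pd 1 (Efun u) q) * pd 0 f q + pd 0 (Efun u) q * pd 1 f q := by
  rw [T1, T2]
  simp only [pd_T1 hu hf, pd_T2 hu hf, pd_Efun hu]
  simp only [pd_comm hf 1 0, pd_comm hf 3 0, pd_comm hf 4 0, pd_comm hf 3 1, pd_comm hf 4 1,
    pd_comm hf 4 3, pd_comm hu 1 0, pd_comm hu 3 0, pd_comm hu 4 0, pd_comm hu 3 1,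
    pd_comm hu 4 1, pd_comm (hu.pd _) 1 0, pd_comm (hu.pd _) 3 0,
    pd_comm (hu.pd _) 4 0, pd_comm (hu.pd _) 3 1]
  ring

end Commutator

/-- `T₁(T₂ f) − T₂(T₁ f) = −(∂_y E) f_x + (∂_x E) f_y` for every smooth `f`;
consequently `T₁, T₂` commute for every `λ` iff `∂_x E = ∂_y E = 0`, and in particular
they commute whenever `E = 0`. -/
theorem stmt4 (u : (Fin 5 → ℝ) → ℝ) (hu : ContDiff ℝ (⊤ : ℕ∞) u) :
    (∀ lam : ℝ, ∀ f : (Fin 5 → ℝ) → ℝ, ContDiff ℝ (⊤ : ℕ∞) f → ∀ q,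
        T1 u lam (T2 u lam f) q - T2 u lam (T1 u lam f) q =
          -(pd 1 (Efun u) q) * pd 0 f q + pd 0 (Efun u) q * pd 1 f q)
    ∧ ((∀ lam : ℝ, ∀ f : (Fin 5 → ℝ) → ℝ, ContDiff ℝ (⊤ : ℕ∞) f → ∀ q,
          T1 u lam (T2 u lam f) q = T2 u lam (T1 u lam f) q)
        ↔ (∀ q, pd 0 (Efun u) q = 0 ∧ pd 1 (Efun u) q = 0))
    ∧ ((∀ q, Efun u q = 0) →
        ∀ lam : ℝ, ∀ f : (Fin 5 → ℝ) → ℝ, ContDiff ℝ (⊤ : ℕ∞) f → ∀ q,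
          T1 u lam (T2 u lam f) q = T2 u lam (T1 u lam f) q) := by
  have comm := fun (lam : ℝ) (f : (Fin 5 → ℝ) → ℝ) (hf : ContDiff ℝ (⊤ : ℕ∞) f) =>
    T1_T2_commutator hu hf lam
  refine ⟨comm, ⟨fun h q => ?_, fun h lam f hf q => ?_⟩, fun h lam f hf q => ?_⟩
  · have coord (j : Fin 5) : ContDiff ℝ (⊤ : ℕ∞) (fun p : Fin 5 → ℝ => p j) :=
      contDiff_apply ℝ ℝ j
    have hx := comm 0 _ (coord 0) q
    have hy := comm 0 _ (coord 1) q
    rw [h 0 _ (coord 0) q] at hx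
    rw [h 0 _ (coord 1) q] at hy
    simp only [pd_coord, Pi.single_apply, Fin.reduceEq, if_true, if_false] at hx hy
    constructor <;> linarith
  · have := comm lam f hf q
    rw [(h q).1, (h q).2] at this
    linarith
  · have hE : Efun u = fun _ => 0 := funext h
    have := comm lam f hf q
    rw [hE, pd_const, pd_const] at this
    linarith
end
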